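/- Every allocation game with repercussion utilities admits at least one pure Nash equilibrium; in particular, any pure action profile s* maximizing F(s) = Σ_{m∈𝒩} u_m(ℓ^{s_m}(s)) over all pure profiles is a pure Nash equilibrium of the game with payoffs r: for every player n and every alternative action s'_n ∈ ℐ_n, r_n(ℓ^{s*_n}(s*)) ≥ r_n(ℓ^{s'_n}(s'_n, s*_{−n})). -/

import Mathlib

/-- The load of action `i` under the pure action profile `s`. -/
def gload {N A : Type*} [Fintype N] [DecidableEq N] [DecidableEq A]
    (s : N → A) (i : A) : Finset N :=
  Finset.univ.filter (fun m => s m = i)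

/-- The repercussion utility of player `n` under the profile `s`. -/
def repAlloc {N A : Type*} [Fintype N] [DecidableEq N] [DecidableEq A]
    (u : N → Finset N → ℝ) (s : N → A) (n : N) : ℝ :=
  u n (gload s (s n)) -
    ∑ m ∈ (gload s (s n)).erase n,
      (u m ((gload s (s n)).erase n) - u m (gload s (s n)))

/-- The potential `F(s) = Σ_{m∈𝒩} u_m(ℓ^{s_m}(s))`. -/
def potAlloc {N A : Type*} [Fintype N] [DecidableEq N] [DecidableEq A]
    (u : N → Finset N → ℝ) (s : N → A) : ℝ :=
  ∑ m : N, u m (gload s (s m))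

/-- The potential splits into the repercussion utility of `n` and a remainder in which
player `n` has been removed from the game. -/
theorem potAlloc_eq_repAlloc_add {N A : Type*} [Fintype N] [DecidableEq N] [DecidableEq A]
    (u : N → Finset N → ℝ) (s : N → A) (n : N) :
    potAlloc u s = repAlloc u s n +
      ∑ m ∈ Finset.univ.erase n, u m ((gload s (s m)).erase n) := by
  have h1 : ∑ m ∈ (gload s (s n)).erase n,
      (u m ((gload s (s n)).erase n) - u m (gload s (s n))) =
      ∑ m ∈ Finset.univ.erase n, (u m ((gload s (s m)).erase n) - u m (gload s (s m))) := by
    have h2 : ∑ m ∈ (gload s (s n)).erase n,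
        (u m ((gload s (s n)).erase n) - u m (gload s (s n))) =
        ∑ m ∈ (gload s (s n)).erase n,
          (u m ((gload s (s m)).erase n) - u m (gload s (s m))) := by
      refine Finset.sum_congr rfl fun m hm => ?_
      have : s m = s n := by simpa [gload] using Finset.mem_of_mem_erase hm
      rw [this]
    rw [h2]
    refine Finset.sum_subset (Finset.erase_subset_erase _ (Finset.subset_univ _)) ?_
    intro m hm hm'
    have hne : m ≠ n := Finset.ne_of_mem_erase hm
    have hs : ¬ s m = s n := by simpa [gload, hne] using hm'
    have : n ∉ gload s (s m) := by
      simpa [gload] using fun h : s n = s m => hs h.symm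
    rw [Finset.erase_eq_of_notMem this, sub_self]
  unfold repAlloc potAlloc
  rw [h1, Finset.sum_sub_distrib,
    ← Finset.add_sum_erase Finset.univ (fun m => u m (gload s (s m))) (Finset.mem_univ n)]
  ring

/-- The remainder does not depend on the action of `n`. -/
theorem remainder_update {N A : Type*} [Fintype N] [DecidableEq N] [DecidableEq A]
    (u : N → Finset N → ℝ) (s : N → A) (n : N) (i : A) :
    ∑ m ∈ Finset.univ.erase n,
      u m ((gload (Function.update s n i) (Function.update s n i m)).erase n) =
    ∑ m ∈ Finset.univ.erase n, u m ((gload s (s m)).erase n) := by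
  refine Finset.sum_congr rfl fun m hm => ?_
  have hne : m ≠ n := Finset.ne_of_mem_erase hm
  congr 1
  ext k
  by_cases hk : k = n <;> simp [gload, hne, hk]

/-- every allocation game with repercussion utilities admits at least one
pure Nash equilibrium; in particular, any pure profile `s*` (with `s* n ∈ ℐ_n`)
maximizing `F(s) = Σ_m u_m(ℓ^{s_m}(s))` over all pure profiles is a pure Nash
equilibrium of the game with payoffs `r`: for every player `n` and every alternative
action `i ∈ ℐ_n`, `r_n(ℓ^{s*_n}(s*)) ≥ r_n(ℓ^{i}(i, s*_{−n}))`. -/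
theorem potential_maximizer_is_pure_nash {N A : Type*}
    [Fintype N] [DecidableEq N] [DecidableEq A]
    (I : N → Finset A) (u : N → Finset N → ℝ)
    (sstar : N → A) (hmem : ∀ n, sstar n ∈ I n)
    (hmax : ∀ s : N → A, (∀ n, s n ∈ I n) → potAlloc u s ≤ potAlloc u sstar) :
    (∃ s : N → A, (∀ n, s n ∈ I n) ∧
        ∀ n : N, ∀ i ∈ I n, repAlloc u (Function.update s n i) n ≤ repAlloc u s n) ∧
      (∀ n : N, ∀ i ∈ I n,
        repAlloc u (Function.update sstar n i) n ≤ repAlloc u sstar n) := by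
  have key : ∀ n : N, ∀ i ∈ I n,
      repAlloc u (Function.update sstar n i) n ≤ repAlloc u sstar n := by
    intro n i hi
    have h := hmax (Function.update sstar n i) (by
      intro m
      by_cases hm : m = n
      · subst hm; simpa using hi
      · simpa [hm] using hmem m)
    rw [potAlloc_eq_repAlloc_add u _ n, potAlloc_eq_repAlloc_add u sstar n,
      remainder_update] at h
    linarith
  exact ⟨⟨sstar, hmem, key⟩, key⟩
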